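/- arXiv:1704.07819 — 2 statements merged into one kernel-verified Lean document; each statement's English description precedes it below -/
import Mathlib

section
/- For F = ℝ and for F = ℂ, the Lie algebra L_F (with the commutator bracket of matrices) is a simple Lie algebra: it is non-abelian and its only Lie ideals are 0 and L_F itself. -/
open Matrix

noncomputable section

/-- Index type for `7×7` matrices in blocks of sizes `1, 3, 3`. -/
abbrev Idx := Fin 1 ⊕ (Fin 3 ⊕ Fin 3)

variable {F : Type} [Field F]

/-- The coordinate matrix `l_x` of `w ↦ x ×₃ w` on `F³`. -/
def lmat (x : Fin 3 → F) : Matrix (Fin 3) (Fin 3) F :=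
  !![0, -x 2, x 1; x 2, 0, -x 0; -x 1, x 0, 0]

/-- The `7×7` block matrix `M(a,x,y) = [[0, -2yᵀ, -2xᵀ], [x, a, l_y], [y, l_x, -aᵀ]]`. -/
def Mmat (a : Matrix (Fin 3) (Fin 3) F) (x y : Fin 3 → F) : Matrix Idx Idx F :=
  Matrix.fromBlocks 0
    (Matrix.of fun _ j => Sum.elim (fun k => -2 * y k) (fun k => -2 * x k) j)
    (Matrix.of fun i _ => Sum.elim x y i)
    (Matrix.fromBlocks a (lmat y) (lmat x) (-aᵀ))

/-- `L_F`: the set of all `M(a,x,y)` for `a` trace-zero and `x, y ∈ F³`. -/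
def LSet (F : Type) [Field F] : Set (Matrix Idx Idx F) :=
  {M | ∃ (a : Matrix (Fin 3) (Fin 3) F) (x y : Fin 3 → F),
    Matrix.trace a = 0 ∧ M = Mmat a x y}

/-- Statement 1 for a given field `F`: the Lie algebra `L_F` (with commutator bracket)
is simple, i.e. it is non-abelian and its only Lie ideals (subspaces `I ⊆ L_F` with
`[L_F, I] ⊆ I`) are `0` and `L_F` itself. -/
def Stmt1 (F : Type) [Field F] : Prop :=
  (∃ A ∈ LSet F, ∃ B ∈ LSet F, A * B - B * A ≠ 0) ∧
  ∀ I : Submodule F (Matrix Idx Idx F),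
    (I : Set (Matrix Idx Idx F)) ⊆ LSet F →
    (∀ A ∈ LSet F, ∀ B ∈ I, A * B - B * A ∈ I) →
    (I : Set (Matrix Idx Idx F)) = {0} ∨ (I : Set (Matrix Idx Idx F)) = LSet F

@[simp]
lemma lmat_zero : lmat (0 : Fin 3 → F) = 0 := by
  ext i j
  fin_cases i <;> fin_cases j <;> simp [lmat]

set_option maxHeartbeats 2000000 in
/-- The commutator of two matrices `M(a,x,y)` and `M(b,u,v)` is again of this form. -/
lemma Mmat_commutator (a b : Matrix (Fin 3) (Fin 3) F) (x y u v : Fin 3 → F)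
    (ha : a.trace = 0) (hb : b.trace = 0) :
    Mmat a x y * Mmat b u v - Mmat b u v * Mmat a x y =
      Mmat (a * b - b * a + (3 : F) • vecMulVec u y - (3 : F) • vecMulVec x v
          + (x ⬝ᵥ v - u ⬝ᵥ y) • (1 : Matrix (Fin 3) (Fin 3) F))
        (a *ᵥ u - b *ᵥ x + (2 : F) • lmat y *ᵥ v)
        (bᵀ *ᵥ y - aᵀ *ᵥ v + (2 : F) • lmat x *ᵥ u) := by
  have ha' : a 2 2 = -a 0 0 - a 1 1 := by
    rw [trace_fin_three] at ha
    linear_combination ha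
  have hb' : b 2 2 = -b 0 0 - b 1 1 := by
    rw [trace_fin_three] at hb
    linear_combination hb
  ext i j
  rcases i with i | i | i <;> rcases j with j | j | j <;> fin_cases i <;> fin_cases j <;>
    simp [Mmat, lmat, Matrix.mul_apply, Fin.sum_univ_three, Matrix.mulVec, dotProduct,
      vecMulVec_apply, vecHead, vecTail, ha', hb'] <;> ring

lemma Mmat_add (a b : Matrix (Fin 3) (Fin 3) F) (x y u v : Fin 3 → F) :
    Mmat a x y + Mmat b u v = Mmat (a + b) (x + u) (y + v) := by
  ext i j
  rcases i with i | i | i <;> rcases j with j | j | j <;> fin_cases i <;> fin_cases j <;>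
    simp [Mmat, lmat] <;> ring

lemma Mmat_smul (c : F) (a : Matrix (Fin 3) (Fin 3) F) (x y : Fin 3 → F) :
    c • Mmat a x y = Mmat (c • a) (c • x) (c • y) := by
  ext i j
  rcases i with i | i | i <;> rcases j with j | j | j <;> fin_cases i <;> fin_cases j <;>
    simp [Mmat, lmat] <;> ring

lemma Mmat_zero : Mmat (0 : Matrix (Fin 3) (Fin 3) F) 0 0 = 0 := by
  simpa using (Mmat_smul (0 : F) 0 0 0).symm

lemma Mmat_mem_LSet {a : Matrix (Fin 3) (Fin 3) F} (ha : a.trace = 0) (x y : Fin 3 → F) :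
    Mmat a x y ∈ LSet F := ⟨a, x, y, ha, rfl⟩

section Ideal

variable {I : Submodule F (Matrix Idx Idx F)}

lemma commutator_mem (hI : ∀ A ∈ LSet F, ∀ B ∈ I, A * B - B * A ∈ I)
    {a b : Matrix (Fin 3) (Fin 3) F} (x y : Fin 3 → F) {u v : Fin 3 → F}
    (ha : a.trace = 0) (hb : b.trace = 0) (h : Mmat b u v ∈ I) :
    Mmat (a * b - b * a + (3 : F) • vecMulVec u y - (3 : F) • vecMulVec x v
          + (x ⬝ᵥ v - u ⬝ᵥ y) • (1 : Matrix (Fin 3) (Fin 3) F))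
        (a *ᵥ u - b *ᵥ x + (2 : F) • lmat y *ᵥ v)
        (bᵀ *ᵥ y - aᵀ *ᵥ v + (2 : F) • lmat x *ᵥ u) ∈ I := by
  rw [← Mmat_commutator a b x y u v ha hb]
  exact hI _ (Mmat_mem_LSet ha x y) _ h

lemma commutator_block_mem (hI : ∀ A ∈ LSet F, ∀ B ∈ I, A * B - B * A ∈ I)
    {a b : Matrix (Fin 3) (Fin 3) F} {u v : Fin 3 → F}
    (ha : a.trace = 0) (hb : b.trace = 0) (h : Mmat b u v ∈ I) :
    Mmat (a * b - b * a) (a *ᵥ u) (-(aᵀ *ᵥ v)) ∈ I := by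
  simpa using commutator_mem hI 0 0 ha hb h

/-- Applying `ad E_ij` twice to `M(b,u,v)` isolates the entry `b j i`. -/
lemma single_mem_of_apply_ne_zero [CharZero F]
    (hI : ∀ A ∈ LSet F, ∀ B ∈ I, A * B - B * A ∈ I)
    {b : Matrix (Fin 3) (Fin 3) F} {u v : Fin 3 → F} (hb : b.trace = 0) (h : Mmat b u v ∈ I)
    {i j : Fin 3} (hij : i ≠ j) (hne : b j i ≠ 0) : Mmat (single i j 1) 0 0 ∈ I := by
  have ht : (single i j (1 : F)).trace = 0 := by simp [trace_single_eq_of_ne _ _ _ hij]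
  have h₁ := commutator_block_mem hI ht hb h
  have h₂ := commutator_block_mem hI ht (by rw [trace_sub, trace_mul_comm, sub_self]) h₁
  have hc : -2 * b j i ≠ 0 := mul_ne_zero (by norm_num) hne
  have hsq : single i j (1 : F) * single i j 1 = 0 := by simp [hij.symm]
  have hsq' : (single i j (1 : F))ᵀ * (single i j 1)ᵀ = 0 := by rw [← transpose_mul, hsq]; simp
  have hmid : single i j (1 : F) * b * single i j 1 = b j i • single i j 1 := by
    simp [Matrix.smul_single]
  have hcomm : single i j (1 : F) * (single i j 1 * b - b * single i j 1)
      - (single i j 1 * b - b * single i j 1) * single i j 1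
      = (-2 * b j i) • single i j 1 := by
    rw [mul_sub, sub_mul, ← mul_assoc, hsq, mul_assoc b, hsq, ← mul_assoc, hmid]
    simp only [zero_mul, mul_zero, mul_smul, neg_smul, two_smul]
    abel
  rw [hcomm, mulVec_mulVec, hsq, mulVec_neg, mulVec_mulVec, hsq', zero_mulVec, zero_mulVec,
    neg_zero, neg_zero] at h₂
  have hs := I.smul_mem (-2 * b j i)⁻¹ h₂
  rwa [Mmat_smul, inv_smul_smul₀ hc, smul_zero] at hs

/-- An ideal containing some `E_ij` with `i ≠ j` is everything. -/
lemma Mmat_mem_of_single_mem [CharZero F]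
    (hI : ∀ A ∈ LSet F, ∀ B ∈ I, A * B - B * A ∈ I) {i j : Fin 3} (hij : i ≠ j)
    (h : Mmat (single i j 1) 0 0 ∈ I) {a : Matrix (Fin 3) (Fin 3) F} (ha : a.trace = 0)
    (x y : Fin 3 → F) : Mmat a x y ∈ I := by
  have ht : (single i j (1 : F)).trace = 0 := by simp [trace_single_eq_of_ne _ _ _ hij]
  have he : Mmat 0 (Pi.single i (1 : F)) 0 ∈ I := by
    have := I.neg_mem (commutator_mem hI (Pi.single j 1) 0 (trace_zero _ _) ht h)
    rw [← neg_one_smul F, Mmat_smul] at this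
    convert this using 2
    · simp
    · ext k
      simp [single_apply, Pi.single_apply, eq_comm]
      split_ifs <;> simp
    · simp
  have hx : ∀ w : Fin 3 → F, Mmat 0 w 0 ∈ I := by
    intro w
    have h₁ := commutator_block_mem hI
      (a := vecMulVec (w - w i • Pi.single i 1) (Pi.single i 1))
      (by simp [trace_vecMulVec]) (trace_zero _ _) he
    have h₂ := I.add_mem h₁ (I.smul_mem (w i) he)
    rw [Mmat_smul, Mmat_add] at h₂
    convert h₂ using 2
    · simp
    · ext k
      simp [vecMulVec_apply]
    · simp
  have hcross : ∀ u w : Fin 3 → F, Mmat 0 0 ((2 : F) • lmat u *ᵥ w) ∈ I := by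
    intro u w
    have := commutator_mem hI u 0 (trace_zero _ _) (trace_zero _ _) (hx w)
    simpa using this
  have hy : ∀ w : Fin 3 → F, Mmat 0 0 w ∈ I := by
    intro w
    have h₁ := I.smul_mem (2 : F)⁻¹ (I.add_mem (I.add_mem (hcross ![0, w 0, 0] ![0, 0, 1])
      (hcross ![0, 0, w 1] ![1, 0, 0])) (hcross ![w 2, 0, 0] ![0, 1, 0]))
    rw [Mmat_add, Mmat_add, Mmat_smul] at h₁
    convert h₁ using 2
    · simp
    · simp
    · ext k
      fin_cases k <;> simp [lmat]
  have hxy : ∀ u w : Fin 3 → F,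
      Mmat ((3 : F) • vecMulVec u w - (u ⬝ᵥ w) • (1 : Matrix (Fin 3) (Fin 3) F)) 0 0 ∈ I := by
    intro u w
    have := commutator_mem hI 0 w (trace_zero _ _) (trace_zero _ _) (hx u)
    simpa [sub_eq_add_neg] using this
  have hmat : Mmat a 0 0 ∈ I := by
    have h₁ := I.smul_mem (3 : F)⁻¹ (I.add_mem (I.add_mem (hxy (a.col 0) (Pi.single 0 1))
      (hxy (a.col 1) (Pi.single 1 1))) (hxy (a.col 2) (Pi.single 2 1)))
    rw [Mmat_add, Mmat_add, Mmat_smul] at h₁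
    have ha' : a 2 2 = -a 0 0 - a 1 1 := by
      rw [trace_fin_three] at ha
      linear_combination ha
    convert h₁ using 2
    · ext k l
      fin_cases k <;> fin_cases l <;> simp [vecMulVec_apply, ha'] <;> field_simp <;> ring
    · simp
    · simp
  simpa [Mmat_add] using I.add_mem (I.add_mem hmat (hx x)) (hy y)

/-- A nonzero ideal contains some `E_ij` with `i ≠ j`. -/
lemma eq_zero_of_single_notMem [CharZero F]
    (hI : ∀ A ∈ LSet F, ∀ B ∈ I, A * B - B * A ∈ I)
    (hno : ∀ i j : Fin 3, i ≠ j → Mmat (single i j (1 : F)) 0 0 ∉ I)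
    {a : Matrix (Fin 3) (Fin 3) F} {x y : Fin 3 → F} (ha : a.trace = 0) (h : Mmat a x y ∈ I) :
    Mmat a x y = 0 := by
  have hoff : ∀ {b : Matrix (Fin 3) (Fin 3) F} {u v : Fin 3 → F}, b.trace = 0 →
      Mmat b u v ∈ I → ∀ i j, i ≠ j → b i j = 0 := fun hb hm i j hij => by
    by_contra hne
    exact hno j i hij.symm (single_mem_of_apply_ne_zero hI hb hm hij.symm hne)
  have hdiag : ∀ i j, i ≠ j → a j j = a i i := fun i j hij => by
    have ht : (single i j (1 : F)).trace = 0 := by simp [trace_single_eq_of_ne _ _ _ hij]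
    have := hoff (by rw [trace_sub, trace_mul_comm, sub_self])
      (commutator_block_mem hI ht ha h) i j hij
    simpa [sub_eq_zero] using this
  have ha0 : a = 0 := by
    have h₁ := hdiag 0 1 (by decide)
    have h₂ := hdiag 0 2 (by decide)
    have h₀ : a 0 0 = 0 := by
      rw [trace_fin_three, h₁, h₂] at ha
      have : (3 : F) * a 0 0 = 0 := by linear_combination ha
      simpa using this
    ext i j
    by_cases hij : i = j
    · subst hij
      fin_cases i <;> simp [h₁, h₂, h₀]
    · exact hoff ha h i j hij
  subst ha0
  have htr : ∀ u w : Fin 3 → F, ((0 : Matrix (Fin 3) (Fin 3) F) * 0 - 0 * 0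
      + (3 : F) • vecMulVec x w - (3 : F) • vecMulVec u y
      + (u ⬝ᵥ y - x ⬝ᵥ w) • (1 : Matrix (Fin 3) (Fin 3) F)).trace = 0 := fun u w => by
    simp [trace_vecMulVec]
    ring
  have hx0 : x = 0 := by
    ext i
    obtain ⟨j, hij⟩ := exists_ne i
    have := hoff (htr 0 (Pi.single j 1))
      (commutator_mem hI 0 (Pi.single j 1) (trace_zero _ _) ha h) i j hij.symm
    simpa [vecMulVec_apply, hij.symm] using this
  have hy0 : y = 0 := by
    ext i
    obtain ⟨j, hij⟩ := exists_ne i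
    have := hoff (htr (Pi.single j 1) 0)
      (commutator_mem hI (Pi.single j 1) 0 (trace_zero _ _) ha h) j i hij
    simpa [vecMulVec_apply, hij] using this
  rw [hx0, hy0, Mmat_zero]

end Ideal

lemma stmt1_of_charZero (F : Type) [Field F] [CharZero F] : Stmt1 F := by
  refine ⟨⟨Mmat 0 (Pi.single 0 1) 0, Mmat_mem_LSet (trace_zero _ _) _ _,
    Mmat 0 (Pi.single 1 1) 0, Mmat_mem_LSet (trace_zero _ _) _ _, fun h => ?_⟩,
    fun I hsub hI => ?_⟩
  · rw [Mmat_commutator _ _ _ _ _ _ (trace_zero _ _) (trace_zero _ _)] at h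
    have := congrFun (congrFun h (Sum.inr (Sum.inr 2))) (Sum.inl 0)
    simp [Mmat, lmat] at this
  · by_cases hno : ∀ i j : Fin 3, i ≠ j → Mmat (single i j (1 : F)) 0 0 ∉ I
    · left
      refine Set.eq_singleton_iff_unique_mem.2 ⟨I.zero_mem, fun B hB => ?_⟩
      obtain ⟨a, x, y, ha, rfl⟩ := hsub hB
      exact eq_zero_of_single_notMem hI hno ha hB
    · right
      push Not at hno
      obtain ⟨i, j, hij, h⟩ := hno
      refine hsub.antisymm ?_
      rintro _ ⟨a, x, y, ha, rfl⟩
      exact Mmat_mem_of_single_mem hI hij h ha x y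

/-- For `F = ℝ` and for `F = ℂ`, the Lie algebra `L_F` (with the commutator bracket
of matrices) is a simple Lie algebra: non-abelian, and its only Lie ideals are `0`
and `L_F` itself. -/
theorem stmt1 : Stmt1 ℝ ∧ Stmt1 ℂ :=
  ⟨stmt1_of_charZero ℝ, stmt1_of_charZero ℂ⟩
end
end

section
/- The extended norm on C is multiplicative: for all P, Q ∈ C, n(P·Q) = n(P)·n(Q). Hence C is an octonion (composition) algebra: a unital 8-dimensional algebra with a nondegenerate multiplicative quadratic form. -/
open Matrix

noncomputable section

/-- `F⁷`, identified with `F × F³ × F³`, elements written `(s, u, v)`. -/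
abbrev V7 (F : Type) := F × (Fin 3 → F) × (Fin 3 → F)

variable {F : Type} [Field F]

/-- The quadratic form `n(s,u,v) = -s² - 4 uᵀv` on `F⁷`. -/
def nq (X : V7 F) : F := -X.1 ^ 2 - 4 * (X.2.1 ⬝ᵥ X.2.2)

/-- The symmetric bilinear form associated to `n` by polarization. -/
def nb (X Y : V7 F) : F := (nq (X + Y) - nq X - nq Y) / 2

/-- The bilinear product `×` on `F⁷`. -/
def cr (X Y : V7 F) : V7 F :=
  (2 * (X.2.1 ⬝ᵥ Y.2.2) - 2 * (X.2.2 ⬝ᵥ Y.2.1),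
   X.1 • Y.2.1 - Y.1 • X.2.1 - (2 : F) • (crossProduct X.2.2 Y.2.2),
   -(X.1 • Y.2.2) + Y.1 • X.2.2 + (2 : F) • (crossProduct X.2.1 Y.2.1))

/-- The octonion algebra `C = F × F⁷`. -/
abbrev Oct (F : Type) := F × V7 F

/-- The product on `C`: `(α,X)·(β,Y) = (αβ − n(X,Y), α·Y + β·X + X × Y)`. -/
def omul (P Q : Oct F) : Oct F :=
  (P.1 * Q.1 - nb P.2 Q.2, P.1 • Q.2 + Q.1 • P.2 + cr P.2 Q.2)

/-- The extended quadratic form on `C`: `n(α,X) = α² + n(X)`. -/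
def onq (P : Oct F) : F := P.1 ^ 2 + nq P.2

/-- The extended bilinear form on `C`: `n((α,X),(β,Y)) = αβ + n(X,Y)`. -/
def onb (P Q : Oct F) : F := P.1 * Q.1 + nb P.2 Q.2

/-- Statement 5 for a given field `F`: the extended norm on `C` is multiplicative,
and `C` is a unital 8-dimensional algebra whose quadratic form is nondegenerate,
i.e. an octonion (composition) algebra. -/
def Stmt5 (F : Type) [Field F] : Prop :=
  (∀ P Q : Oct F, onq (omul P Q) = onq P * onq Q) ∧
  (∀ P : Oct F, omul ((1, 0) : Oct F) P = P ∧ omul P ((1, 0) : Oct F) = P) ∧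
  Module.finrank F (Oct F) = 8 ∧
  (∀ P : Oct F, (∀ Q : Oct F, onb P Q = 0) → P = 0)

theorem nb_eq (h2 : (2 : F) ≠ 0) (X Y : V7 F) :
    nb X Y = -(X.1 * Y.1) - 2 * (X.2.1 ⬝ᵥ Y.2.2 + X.2.2 ⬝ᵥ Y.2.1) := by
  unfold nb nq
  rw [div_eq_iff h2]
  simp only [Prod.fst_add, Prod.snd_add, add_dotProduct, dotProduct_add,
    dotProduct_comm X.2.2 Y.2.1]
  ring

theorem onq_omul (h2 : (2 : F) ≠ 0) (P Q : Oct F) : onq (omul P Q) = onq P * onq Q := by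
  obtain ⟨a, s, u, v⟩ := P
  obtain ⟨b, t, x, y⟩ := Q
  simp only [onq, omul, nb_eq h2]
  simp only [nq, cr, cross_apply, dotProduct, Fin.sum_univ_three, Prod.fst_add, Prod.snd_add,
    Prod.smul_fst, Prod.smul_snd, Pi.add_apply, Pi.sub_apply, Pi.neg_apply, Pi.smul_apply,
    smul_eq_mul, cons_val]
  ring

theorem one_omul (P : Oct F) : omul ((1, 0) : Oct F) P = P := by
  ext <;> simp [omul, nb, nq, cr]

theorem omul_one (P : Oct F) : omul P ((1, 0) : Oct F) = P := by
  ext <;> simp [omul, nb, nq, cr]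

theorem finrank_oct : Module.finrank F (Oct F) = 8 := by
  simp [Module.finrank_prod]

theorem onb_nondegenerate (h2 : (2 : F) ≠ 0) (P : Oct F) (h : ∀ Q : Oct F, onb P Q = 0) :
    P = 0 := by
  obtain ⟨a, s, u, v⟩ := P
  simp only [onb, nb_eq h2] at h
  have ha : a = 0 := by simpa using h (1, 0)
  have hs : s = 0 := by simpa using h (0, 1, 0)
  have hu : u = 0 := funext fun i => by simpa [h2] using h (0, 0, 0, Pi.single i 1)
  have hv : v = 0 := funext fun i => by simpa [h2] using h (0, 0, Pi.single i 1, 0)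
  simp [ha, hs, hu, hv]

theorem stmt5_of_two_ne_zero (h2 : (2 : F) ≠ 0) : Stmt5 F :=
  ⟨onq_omul h2, fun P => ⟨one_omul P, omul_one P⟩, finrank_oct, onb_nondegenerate h2⟩

/-- For `F = ℝ` and `F = ℂ`: the extended norm on `C` is multiplicative,
`n(P·Q) = n(P)·n(Q)` for all `P, Q ∈ C`; hence `C` is an octonion (composition)
algebra: a unital 8-dimensional algebra with a nondegenerate multiplicative
quadratic form. -/
theorem stmt5 : Stmt5 ℝ ∧ Stmt5 ℂ := by
  exact ⟨stmt5_of_two_ne_zero two_ne_zero, stmt5_of_two_ne_zero two_ne_zero⟩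
end
end
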